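/- arXiv:1508.07764 — 2 statements merged into one kernel-verified Lean document; each statement's English description precedes it below -/
import Mathlib

section
/- For every even Schwartz function ρ on ℝ and all x, z ∈ ℝ, the convolution ρ * Θ_x is differentiable in z and d/dz (ρ * Θ_x)(z) = −ρ(x − z) + (ρ * σ)(z). -/
open MeasureTheory Real

/-- `Θ_x(z) = 1_{(-∞,x]}(z) - ∫_z^∞ σ(y) dy`. -/
noncomputable def Theta (σ : ℝ → ℝ) (x z : ℝ) : ℝ :=
  Set.indicator (Set.Iic x) (fun _ => (1 : ℝ)) z - ∫ y in Set.Ioi z, σ y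

/-- The tail integral of a continuous integrable function has derivative `-f`. -/
theorem hasDerivAt_integral_Ioi {f : ℝ → ℝ} (hf : Integrable f) (hc : Continuous f) (w : ℝ) :
    HasDerivAt (fun t => ∫ y in Set.Ioi t, f y) (-f w) w := by
  have h : (fun t => ∫ y in Set.Ioi t, f y) =
      fun t => (∫ y in Set.Ioi (0 : ℝ), f y) - ∫ y in (0 : ℝ)..t, f y := by
    funext t
    rw [← intervalIntegral.integral_Ioi_sub_Ioi' hf.integrableOn hf.integrableOn]
    ring
  rw [h]
  exact (intervalIntegral.integral_hasDerivAt_right (hc.intervalIntegrable _ _)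
    (hc.stronglyMeasurableAtFilter _ _) hc.continuousAt).const_sub _

/-- Convolution with the indicator of `(-∞, x]` is a tail integral. -/
theorem integral_comp_sub_mul_indicator_Iic (f : ℝ → ℝ) (x t : ℝ) :
    ∫ w, f (t - w) * Set.indicator (Set.Iic x) (fun _ => (1 : ℝ)) w =
      ∫ y in Set.Ioi (t - x), f y := by
  rw [← integral_Ici_eq_integral_Ioi, ← integral_indicator measurableSet_Ici,
    ← integral_sub_left_eq_self _ volume t]
  congr 1
  funext w
  simp [Set.indicator, add_comm]

/-- Differentiation of a convolution, with the derivative falling on the bounded factor. -/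
theorem hasDerivAt_integral_comp_sub_mul {f S s : ℝ → ℝ} (hf : Integrable f)
    (hS : ∀ w, HasDerivAt S (s w) w) (hs : Continuous s) {B C : ℝ} (hB : ∀ w, ‖S w‖ ≤ B)
    (hC : ∀ w, ‖s w‖ ≤ C) (z : ℝ) :
    HasDerivAt (fun t => ∫ w, f (t - w) * S w) (∫ w, f (z - w) * s w) z := by
  have flip : ∀ (g : ℝ → ℝ) (t : ℝ), ∫ w, f (t - w) * g w = ∫ u, f u * g (t - u) := by
    intro g t
    rw [← integral_sub_left_eq_self (fun u => f u * g (t - u)) volume t]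
    simp
  simp only [flip]
  have hSc : Continuous S := continuous_iff_continuousAt.2 fun w => (hS w).continuousAt
  refine (hasDerivAt_integral_of_dominated_loc_of_deriv_le
    (F := fun t u => f u * S (t - u)) (F' := fun t u => f u * s (t - u)) (bound := fun u => ‖f u‖ * C)
    Filter.univ_mem ?_ ?_ ?_ ?_ (hf.norm.mul_const C) ?_).2
  · exact .of_forall fun t => hf.aestronglyMeasurable.mul
      (hSc.comp (continuous_const.sub continuous_id)).aestronglyMeasurable
  · exact hf.mul_bdd (hSc.comp (continuous_const.sub continuous_id)).aestronglyMeasurable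
      (.of_forall fun u => hB _)
  · exact hf.aestronglyMeasurable.mul
      (hs.comp (continuous_const.sub continuous_id)).aestronglyMeasurable
  · refine .of_forall fun u t _ => ?_
    rw [norm_mul]
    exact mul_le_mul_of_nonneg_left (hC _) (norm_nonneg _)
  · refine .of_forall fun u t _ => ?_
    exact ((hS (t - u)).comp_sub_const t u).const_mul (f u)

theorem stmt_4 (σ : ℝ → ℝ) (hσ_smooth : ContDiff ℝ (⊤ : ℕ∞) σ) (hσ_supp : HasCompactSupport σ)
    (hσ_nonneg : ∀ y, 0 ≤ σ y) (hσ_int : ∫ y, σ y = 1)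
    (ρ : SchwartzMap ℝ ℝ) (hρ_even : ∀ y, ρ (-y) = ρ y) (x z : ℝ) :
    HasDerivAt (fun z' => ∫ w, ρ (z' - w) * Theta σ x w)
      (-ρ (x - z) + ∫ w, ρ (z - w) * σ w) z := by
  have hσc := hσ_smooth.continuous
  have hσi : Integrable σ := hσc.integrable_of_hasCompactSupport hσ_supp
  have hρi : Integrable (ρ : ℝ → ℝ) := ρ.integrable
  have hS := hasDerivAt_integral_Ioi hσi hσc
  have hSc : Continuous fun w => ∫ y in Set.Ioi w, σ y :=
    continuous_iff_continuousAt.2 fun w => (hS w).continuousAt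
  have hSb : ∀ w, ‖∫ y in Set.Ioi w, σ y‖ ≤ 1 := fun w => by
    rw [Real.norm_of_nonneg (integral_nonneg hσ_nonneg), ← hσ_int]
    exact setIntegral_le_integral hσi (.of_forall hσ_nonneg)
  obtain ⟨C, hC⟩ := hσ_supp.exists_bound_of_continuous hσc
  have hsplit : (fun z' => ∫ w, ρ (z' - w) * Theta σ x w) = fun z' =>
      (∫ y in Set.Ioi (z' - x), ρ y) - ∫ w, ρ (z' - w) * ∫ y in Set.Ioi w, σ y := by
    funext t
    have hρt : Integrable fun w => ρ (t - w) := hρi.comp_sub_left t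
    rw [← integral_comp_sub_mul_indicator_Iic, ← integral_sub]
    · simp only [Theta, mul_sub]
    · refine hρt.mul_bdd (c := 1)
        (measurable_const.indicator measurableSet_Iic).aestronglyMeasurable (.of_forall fun w => ?_)
      exact (norm_indicator_le_norm_self _ _).trans (by simp)
    · exact hρt.mul_bdd hSc.aestronglyMeasurable (.of_forall hSb)
  rw [hsplit]
  have h₁ : HasDerivAt (fun t => ∫ y in Set.Ioi (t - x), ρ y) (-ρ (z - x)) z := by
    exact (hasDerivAt_integral_Ioi hρi ρ.continuous (z - x)).comp_sub_const z x
  have h₂ := hasDerivAt_integral_comp_sub_mul hρi hS hσc.neg hSb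
    (fun w => by simpa using hC w) z
  refine (h₁.sub h₂).congr_deriv ?_
  rw [← hρ_even (x - z), neg_sub]
  simp only [mul_neg, integral_neg, sub_neg_eq_add]
end

section
/- For every even Schwartz function ρ on ℝ with ∫_ℝ ρ(y) dy = 1 and every x ∈ ℝ: lim_{L → ∞} (ρ^L * ρ^L * Θ_x)(x) = 1/2 − ∫_x^∞ σ(y) dy, where ρ^L(y) := Lρ(Ly). -/
open MeasureTheory Real Filter

/-- The rescaled mollifier `ρ^L(y) = L ρ(L y)`. -/
noncomputable def mollify (ρ : ℝ → ℝ) (L : ℕ) (y : ℝ) : ℝ := (L : ℝ) * ρ ((L : ℝ) * y)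

open scoped Convolution

theorem continuous_integral_Ioi {σ : ℝ → ℝ} (hσ : Integrable σ) :
    Continuous fun z => ∫ y in Set.Ioi z, σ y := by
  have h : (fun z => ∫ y in Set.Ioi z, σ y)
      = fun z => (∫ y in Set.Ioi 0, σ y) - ∫ y in (0 : ℝ)..z, σ y := by
    ext z
    have := intervalIntegral.integral_Ioi_sub_Ioi' (a := 0) (b := z) (μ := volume) (f := σ)
      hσ.integrableOn hσ.integrableOn
    linarith
  rw [h]
  exact continuous_const.sub
    (intervalIntegral.continuous_primitive (fun a b => hσ.intervalIntegrable) 0)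

theorem measurable_Theta {σ : ℝ → ℝ} (hσ : Integrable σ) (x : ℝ) : Measurable (Theta σ x) :=
  (measurable_const.indicator measurableSet_Iic).sub (continuous_integral_Ioi hσ).measurable

theorem abs_Theta_le {σ : ℝ → ℝ} (hσ : Integrable σ) (hσ_nonneg : ∀ y, 0 ≤ σ y)
    (hσ_int : ∫ y, σ y = 1) (x z : ℝ) : |Theta σ x z| ≤ 1 := by
  have h0 : 0 ≤ ∫ y in Set.Ioi z, σ y := integral_nonneg hσ_nonneg
  have h1 : ∫ y in Set.Ioi z, σ y ≤ 1 :=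
    hσ_int ▸ setIntegral_le_integral hσ (Eventually.of_forall hσ_nonneg)
  unfold Theta
  by_cases hz : z ∈ Set.Iic x
  · rw [Set.indicator_of_mem hz, abs_le]
    constructor <;> linarith
  · rw [Set.indicator_of_notMem hz, abs_le]
    constructor <;> linarith

theorem tendsto_Theta_sub_div {σ : ℝ → ℝ} (hσ : Integrable σ) (x : ℝ) {u : ℝ} (hu : u ≠ 0) :
    Tendsto (fun L : ℕ => Theta σ x (x - u / L)) atTop
      (nhds (Set.indicator (Set.Ioi 0) (fun _ => (1 : ℝ)) u - ∫ y in Set.Ioi x, σ y)) := by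
  unfold Theta
  refine Tendsto.sub ?_ ?_
  · refine tendsto_const_nhds.congr' ?_
    filter_upwards [eventually_gt_atTop 0] with L hL
    have hL' : (0 : ℝ) < L := Nat.cast_pos.mpr hL
    rcases hu.lt_or_gt with h | h
    · have : u / L < 0 := div_neg_of_neg_of_pos h hL'
      rw [Set.indicator_of_notMem (by simpa using h.le),
        Set.indicator_of_notMem (by simpa using this)]
    · have : 0 < u / L := div_pos h hL'
      rw [Set.indicator_of_mem (by simpa using h), Set.indicator_of_mem (by simpa using this.le)]
  · have h : Tendsto (fun L : ℕ => x - u / L) atTop (nhds x) := by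
      simpa using tendsto_const_nhds (x := x).sub (tendsto_const_div_atTop_nhds_zero_nat u)
    exact ((continuous_integral_Ioi hσ).tendsto x).comp h

theorem integral_Ioi_of_even {φ : ℝ → ℝ} (hφ : Integrable φ) (hφ_even : ∀ u, φ (-u) = φ u) :
    ∫ u in Set.Ioi 0, φ u = (∫ u, φ u) / 2 := by
  have h1 := integral_add_compl (μ := volume) (s := Set.Ioi (0 : ℝ)) measurableSet_Ioi hφ
  have h2 := integral_comp_neg_Ioi (0 : ℝ) φ
  rw [Set.compl_Ioi] at h1
  simp only [hφ_even, neg_zero] at h2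
  linarith

theorem tendsto_integral_mul_Theta {σ : ℝ → ℝ} (hσ : Integrable σ) (hσ_nonneg : ∀ y, 0 ≤ σ y)
    (hσ_int : ∫ y, σ y = 1) {φ : ℝ → ℝ} (hφ : Integrable φ) (hφ_even : ∀ u, φ (-u) = φ u)
    (hφ_int : ∫ u, φ u = 1) (x : ℝ) :
    Tendsto (fun L : ℕ => ∫ u, φ u * Theta σ x (x - u / L)) atTop
      (nhds (1 / 2 - ∫ y in Set.Ioi x, σ y)) := by
  have hlim : ∫ u, φ u * (Set.indicator (Set.Ioi 0) (fun _ => (1 : ℝ)) u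
      - ∫ y in Set.Ioi x, σ y) = 1 / 2 - ∫ y in Set.Ioi x, σ y := by
    have h : ∀ u, φ u * (Set.indicator (Set.Ioi 0) (fun _ => (1 : ℝ)) u
        - ∫ y in Set.Ioi x, σ y)
        = Set.indicator (Set.Ioi 0) φ u - φ u * ∫ y in Set.Ioi x, σ y := by
      intro u
      by_cases hu : u ∈ Set.Ioi (0 : ℝ) <;> simp [hu, mul_sub]
    simp_rw [h]
    rw [integral_sub (hφ.indicator measurableSet_Ioi) (hφ.mul_const _),
      integral_indicator measurableSet_Ioi, integral_mul_const, integral_Ioi_of_even hφ hφ_even,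
      hφ_int, one_mul]
  rw [← hlim]
  refine tendsto_integral_of_dominated_convergence (fun u => ‖φ u‖) (fun L => ?_) hφ.norm
    (fun L => ?_) ?_
  · exact hφ.aestronglyMeasurable.mul
      ((measurable_Theta hσ x).comp (by fun_prop)).aestronglyMeasurable
  · refine Eventually.of_forall fun u => ?_
    rw [norm_mul]
    exact mul_le_of_le_one_right (norm_nonneg _) (abs_Theta_le hσ hσ_nonneg hσ_int x _)
  · filter_upwards [compl_mem_ae_iff.mpr (measure_singleton (0 : ℝ))] with u hu
    exact (tendsto_Theta_sub_div hσ x hu).const_mul _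

theorem integral_mollify_mul_mollify (ρ : ℝ → ℝ) {L : ℕ} (hL : 0 < L) (y : ℝ) :
    ∫ w, mollify ρ L (y - w) * mollify ρ L w
      = L * (ρ ⋆[ContinuousLinearMap.mul ℝ ℝ] ρ) (L * y) := by
  have hL' : (0 : ℝ) < L := Nat.cast_pos.mpr hL
  have h := Measure.integral_comp_mul_left (fun v => ρ v * ρ (L * y - v)) (L : ℝ)
  simp only [convolution_def, ContinuousLinearMap.mul_apply', mollify]
  rw [abs_of_pos (inv_pos.mpr hL'), smul_eq_mul] at h
  calc _ = ∫ w, ((L : ℝ) * L) * (ρ (L * w) * ρ (L * y - L * w)) := by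
        congr 1; ext w; rw [mul_sub]; ring
    _ = _ := by rw [integral_const_mul, h]; field_simp

theorem integral_scale_mul (φ g : ℝ → ℝ) {L : ℕ} (hL : 0 < L) (x : ℝ) :
    ∫ z, (L * φ (L * (x - z))) * g z = ∫ u, φ u * g (x - u / L) := by
  have hL' : (0 : ℝ) < L := Nat.cast_pos.mpr hL
  have h := Measure.integral_comp_mul_left (fun u => φ u * g (x - u / L)) (L : ℝ)
  rw [abs_of_pos (inv_pos.mpr hL'), smul_eq_mul] at h
  rw [← integral_sub_left_eq_self _ volume x]
  calc _ = ∫ z, (L : ℝ) * (φ (L * z) * g (x - L * z / L)) := by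
        congr 1; ext z
        rw [mul_div_cancel_left₀ _ hL'.ne', sub_sub_cancel]; ring
    _ = _ := by rw [integral_const_mul, h]; field_simp

theorem convolution_even {ρ : ℝ → ℝ} (hρ : ∀ y, ρ (-y) = ρ y) (u : ℝ) :
    (ρ ⋆[ContinuousLinearMap.mul ℝ ℝ] ρ) (-u) = (ρ ⋆[ContinuousLinearMap.mul ℝ ℝ] ρ) u := by
  simp only [convolution_def, ContinuousLinearMap.mul_apply']
  rw [← integral_neg_eq_self]
  congr 1; ext t
  rw [hρ t, ← hρ (u - t)]
  congr 2; ring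

theorem stmt_6 (σ : ℝ → ℝ) (hσ_smooth : ContDiff ℝ (⊤ : ℕ∞) σ) (hσ_supp : HasCompactSupport σ)
    (hσ_nonneg : ∀ y, 0 ≤ σ y) (hσ_int : ∫ y, σ y = 1)
    (ρ : SchwartzMap ℝ ℝ) (hρ_even : ∀ y, ρ (-y) = ρ y) (hρ_int : ∫ y, ρ y = 1) (x : ℝ) :
    Tendsto
      (fun L : ℕ =>
        ∫ z, (∫ w, mollify ρ L (x - z - w) * mollify ρ L w) * Theta σ x z)
      atTop (nhds (1 / 2 - ∫ y in Set.Ioi x, σ y)) := by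
  have hσ : Integrable σ := hσ_smooth.continuous.integrable_of_hasCompactSupport hσ_supp
  have hρ : Integrable ρ := ρ.integrable
  have hφ_int : ∫ u, (ρ ⋆[ContinuousLinearMap.mul ℝ ℝ] ρ) u = 1 := by
    rw [integral_convolution _ hρ hρ, hρ_int]
    simp
  refine (tendsto_integral_mul_Theta hσ hσ_nonneg hσ_int
    (hρ.integrable_convolution (ContinuousLinearMap.mul ℝ ℝ) hρ)
    (convolution_even hρ_even) hφ_int x).congr' ?_
  filter_upwards [eventually_gt_atTop 0] with L hL
  simp_rw [integral_mollify_mul_mollify ρ hL]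
  exact (integral_scale_mul _ _ hL x).symm
end
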